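/- The tensor product over F_p of finitely many fields, each of which is a finitely generated field extension of F_p, is a Noetherian ring. -/

import Mathlib

open scoped TensorProduct

theorem aux_step {R S B : Type*} [CommRing R] [CommRing S] [CommRing B] [Algebra R S] [Algebra R B]
    [Algebra.EssFiniteType R B] (A : Subalgebra R S) [Algebra.EssFiniteType R A] (g : B →ₐ[R] S) :
    Algebra.EssFiniteType R (A ⊔ g.range : Subalgebra R S) := by
  have h : (Algebra.TensorProduct.productMap A.val g).range = A ⊔ g.range := by
    rw [Algebra.TensorProduct.productMap_range, Subalgebra.range_val]
  rw [← h]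
  have : Algebra.EssFiniteType R (A ⊗[R] B) := Algebra.EssFiniteType.comp R A (A ⊗[R] B)
  exact Algebra.EssFiniteType.of_surjective
    (Algebra.TensorProduct.productMap A.val g).rangeRestrict (AlgHom.rangeRestrict_surjective _)

theorem aux_sup {R S ι : Type*} {B : ι → Type*} [CommRing R] [CommRing S] [∀ i, CommRing (B i)]
    [Algebra R S] [∀ i, Algebra R (B i)] [∀ i, Algebra.EssFiniteType R (B i)]
    (g : ∀ i, B i →ₐ[R] S) (s : Finset ι) :
    ∃ A : Subalgebra R S, Algebra.EssFiniteType R A ∧ ∀ i ∈ s, (g i).range ≤ A := by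
  classical
  induction s using Finset.induction_on with
  | empty =>
    refine ⟨(Algebra.ofId R S).range, ?_, by simp⟩
    exact Algebra.EssFiniteType.of_surjective (Algebra.ofId R S).rangeRestrict
      (AlgHom.rangeRestrict_surjective _)
  | insert i s hi ih =>
    obtain ⟨A, hA, h⟩ := ih
    refine ⟨A ⊔ (g i).range, aux_step A (g i), fun j hj => ?_⟩
    rcases Finset.mem_insert.1 hj with rfl | hj
    · exact le_sup_right
    · exact (h j hj).trans le_sup_left

/-- The tensor product over `𝔽_p` of finitely many fields, each of which is a finitely
generated field extension of `𝔽_p`, is a Noetherian ring. -/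
theorem tensor_product_of_fg_field_extensions_isNoetherianRing
    (p : ℕ) [Fact p.Prime] (n : ℕ) (K : Fin n → Type*) [∀ i, Field (K i)]
    [∀ i, Algebra (ZMod p) (K i)]
    (hfg : ∀ i, ∃ s : Finset (K i),
      IntermediateField.adjoin (ZMod p) (s : Set (K i)) = ⊤) :
    IsNoetherianRing (PiTensorProduct (ZMod p) K) := by
  have hK : ∀ i, Algebra.EssFiniteType (ZMod p) (K i) := fun i =>
    IntermediateField.fg_top_iff.1 (hfg i)
  obtain ⟨A, hA, h⟩ := aux_sup (R := ZMod p) (S := PiTensorProduct (ZMod p) K)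
    (fun i => PiTensorProduct.singleAlgHom (R := ZMod p) (A := K) i) Finset.univ
  have key : ∀ x : PiTensorProduct (ZMod p) K, x ∈ A := by
    intro x
    induction x using PiTensorProduct.induction_on with
    | smul_tprod r f =>
      refine A.smul_mem ?_ r
      rw [← Finset.univ_prod_mulSingle f, PiTensorProduct.tprod_prod]
      exact A.prod_mem fun i hi => h i hi ⟨f i, rfl⟩
    | add x y hx hy => exact A.add_mem hx hy
  have : Algebra.EssFiniteType (ZMod p) (PiTensorProduct (ZMod p) K) :=
    Algebra.EssFiniteType.of_surjective A.val fun x => ⟨⟨x, key x⟩, rfl⟩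
  exact Algebra.EssFiniteType.isNoetherianRing (ZMod p) _
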